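/- Let n ≥ 2, let X be a set, let x₁,…,xₙ ∈ X, and for each k ∈ ℕ let Kₖ : X × X → ℂ satisfy Kₖ(y,x) = (−1)^{k+1} Kₖ(x,y) for all x, y. For m ∈ ℕ define G_m = Σ_τ Σ_{(k₁,…,kₙ)} Π_{i=1}^{n} K_{kᵢ}(xᵢ, x_{τ(i)}), where τ ranges over all permutations of {1,…,n} consisting of a single n-cycle and (k₁,…,kₙ) ranges over all n-tuples of natural numbers with k₁+⋯+kₙ = m. Then G_m = 0 whenever n + m is odd. -/

import Mathlib

open scoped Classical in
/-- Cancellation of odd/even coefficients in the determinantal formula: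
if each Kₖ satisfies Kₖ(y,x) = (−1)^{k+1}Kₖ(x,y), then the sum over single
n-cycles τ and over tuples (k₁,…,kₙ) with Σkᵢ = m of Πᵢ K_{kᵢ}(xᵢ, x_{τ(i)})
vanishes whenever n + m is odd. -/
theorem statement15 (n m : ℕ) (hn : 2 ≤ n) (X : Type*) (x : Fin n → X)
    (K : ℕ → X → X → ℂ)
    (hK : ∀ (k : ℕ) (a b : X), K k b a = (-1 : ℂ) ^ (k + 1) * K k a b)
    (hodd : Odd (n + m)) :
    (∑ τ ∈ Finset.univ.filter
        (fun τ : Equiv.Perm (Fin n) => τ.IsCycle ∧ τ.support = Finset.univ),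
      ∑ kv ∈ Finset.Nat.antidiagonalTuple n m,
        ∏ i : Fin n, K (kv i) (x i) (x (τ i))) = 0 := by
  have key : ∀ τ : Equiv.Perm (Fin n),
      (∑ kv ∈ Finset.Nat.antidiagonalTuple n m, ∏ i : Fin n, K (kv i) (x i) (x (τ⁻¹ i)))
        = - ∑ kv ∈ Finset.Nat.antidiagonalTuple n m, ∏ i : Fin n, K (kv i) (x i) (x (τ i)) := by
    intro τ
    rw [← Finset.sum_neg_distrib]
    refine Finset.sum_bij' (fun kv _ => kv ∘ τ) (fun kv _ => kv ∘ τ.symm) ?_ ?_ ?_ ?_ ?_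
    · intro kv h
      rw [Finset.Nat.mem_antidiagonalTuple] at h ⊢
      rw [← h]
      exact Equiv.sum_comp τ kv
    · intro kv h
      rw [Finset.Nat.mem_antidiagonalTuple] at h ⊢
      rw [← h]
      exact Equiv.sum_comp τ.symm kv
    · intro kv _
      funext i
      simp
    · intro kv _
      funext i
      simp
    · intro kv h
      rw [Finset.Nat.mem_antidiagonalTuple] at h
      rw [← Equiv.prod_comp τ]
      have h1 : ∀ i, K (kv (τ i)) (x (τ i)) (x (τ⁻¹ (τ i)))
          = (-1 : ℂ) ^ (kv (τ i) + 1) * K (kv (τ i)) (x i) (x (τ i)) := by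
        intro i
        rw [show τ⁻¹ (τ i) = i from τ.symm_apply_apply i]
        exact hK _ _ _
      rw [Finset.prod_congr rfl (fun i _ => h1 i), Finset.prod_mul_distrib,
        Finset.prod_pow_eq_pow_sum]
      have h2 : ∑ i, (kv (τ i) + 1) = n + m := by
        rw [Finset.sum_add_distrib, Equiv.sum_comp τ kv, h]
        simp [add_comm]
      rw [h2, hodd.neg_one_pow, neg_one_mul]
      rfl
  apply self_eq_neg.mp
  rw [← Finset.sum_neg_distrib]
  refine Finset.sum_bij' (fun τ _ => τ⁻¹) (fun τ _ => τ⁻¹) ?_ ?_ ?_ ?_ ?_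
  · intro τ h
    simp only [Finset.mem_filter, Finset.mem_univ, true_and] at h ⊢
    exact ⟨h.1.inv, by rw [Equiv.Perm.support_inv]; exact h.2⟩
  · intro τ h
    simp only [Finset.mem_filter, Finset.mem_univ, true_and] at h ⊢
    exact ⟨h.1.inv, by rw [Equiv.Perm.support_inv]; exact h.2⟩
  · intro τ _
    exact inv_inv τ
  · intro τ _
    exact inv_inv τ
  · intro τ _
    rw [key τ, neg_neg]
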